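/- Let u : ℝ × ℝⁿ → ℝⁿ and v : ℝ × ℝⁿ → ℝᵏ be C¹, let s : ℝ × ℝⁿ → Matrix k k ℝ be continuous with s(t,x) skew-symmetric for all (t,x), let c : ℝ × ℝⁿ → ℝ be continuous, and set a := s + c·I (pointwise, where I is the k×k identity matrix), so that a is valued in the conformal Lie algebra conf(k). If v satisfies ∂_t v = -(D_x v) u - (1/2)(div_x u) v + a v pointwise, then ρ(t,x) := ‖v(t,x)‖² satisfies ∂_t ρ + div_x(ρ u) = 2 c ρ; equivalently, since c = tr(a)/k, one has ∂_t ρ + div_x(ρ u) = (2/k) tr(a) ρ, so the total mass is no longer conserved and the transport is unbalanced. -/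

import Mathlib

open Matrix

noncomputable section

/-- The divergence of a vector field on `ℝⁿ`: the trace of its Fréchet derivative. -/
def sdiv {n : ℕ} (w : EuclideanSpace ℝ (Fin n) → EuclideanSpace ℝ (Fin n))
    (x : EuclideanSpace ℝ (Fin n)) : ℝ :=
  LinearMap.trace ℝ (EuclideanSpace ℝ (Fin n)) (fderiv ℝ w x).toLinearMap

theorem inner_toEuclideanLin_self_eq_zero_of_transpose_eq_neg {k : ℕ}
    {A : Matrix (Fin k) (Fin k) ℝ} (hA : Aᵀ = -A) (w : EuclideanSpace ℝ (Fin k)) :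
    inner ℝ w (Matrix.toEuclideanLin A w) = 0 := by
  have key : inner ℝ w (Matrix.toEuclideanLin A w) = -inner ℝ w (Matrix.toEuclideanLin A w) := by
    conv_lhs =>
      rw [← LinearMap.adjoint_inner_left, ← Matrix.toEuclideanLin_conjTranspose_eq_adjoint,
        Matrix.conjTranspose_eq_transpose_of_trivial, hA, map_neg, LinearMap.neg_apply,
        inner_neg_left, real_inner_comm]
  linarith

theorem trace_eq_zero_of_transpose_eq_neg {k : ℕ}
    {A : Matrix (Fin k) (Fin k) ℝ} (hA : Aᵀ = -A) : A.trace = 0 := by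
  have h := congrArg Matrix.trace hA
  rw [Matrix.trace_transpose, Matrix.trace_neg] at h
  linarith

theorem deriv_norm_sq_eq {F : Type*} [NormedAddCommGroup F] [InnerProductSpace ℝ F]
    {f : ℝ → F} {t : ℝ} (hf : DifferentiableAt ℝ f t) :
    deriv (fun τ => ‖f τ‖ ^ 2) t = 2 * inner ℝ (f t) (deriv f t) :=
  hf.hasDerivAt.norm_sq.deriv

theorem inner_gradient_norm_sq {E F : Type*} [NormedAddCommGroup E] [InnerProductSpace ℝ E]
    [CompleteSpace E] [NormedAddCommGroup F] [InnerProductSpace ℝ F]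
    {f : E → F} {x : E} (hf : DifferentiableAt ℝ f x) (w : E) :
    inner ℝ (gradient (fun y => ‖f y‖ ^ 2) x) w = 2 * inner ℝ (f x) (fderiv ℝ f x w) := by
  rw [gradient, InnerProductSpace.toDual_symm_apply, hf.hasFDerivAt.norm_sq.fderiv]
  simp

/-- Unbalanced vector transport: if `v` is transported by
`∂ₜ v = -(Dₓ v) u - (1/2)(div u) v + a v` where `a = s + c·I` is valued in the
conformal Lie algebra `conf(k) = so(k) ⊕ ℝ·I`, then `ρ = ‖v‖²` satisfies
`∂ₜ ρ + div(ρ u) = 2 c ρ = (2/k) tr(a) ρ`: the total mass is not conserved. -/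
theorem unbalanced_halfDensity_transport {n k : ℕ}
    (u : ℝ × EuclideanSpace ℝ (Fin n) → EuclideanSpace ℝ (Fin n))
    (hu : ContDiff ℝ 1 u)
    (v : ℝ × EuclideanSpace ℝ (Fin n) → EuclideanSpace ℝ (Fin k))
    (hv : ContDiff ℝ 1 v)
    (s : ℝ × EuclideanSpace ℝ (Fin n) → Matrix (Fin k) (Fin k) ℝ)
    (hs : Continuous s)
    (hsskew : ∀ (t : ℝ) (x : EuclideanSpace ℝ (Fin n)), (s (t, x))ᵀ = -s (t, x))
    (c : ℝ × EuclideanSpace ℝ (Fin n) → ℝ) (hc : Continuous c)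
    (a : ℝ × EuclideanSpace ℝ (Fin n) → Matrix (Fin k) (Fin k) ℝ)
    (hadef : ∀ p, a p = s p + c p • (1 : Matrix (Fin k) (Fin k) ℝ))
    (htransport : ∀ (t : ℝ) (x : EuclideanSpace ℝ (Fin n)),
      deriv (fun τ => v (τ, x)) t =
        -(fderiv ℝ (fun y => v (t, y)) x (u (t, x)))
        - (((1 : ℝ) / 2) * sdiv (fun y => u (t, y)) x) • v (t, x)
        + Matrix.toEuclideanLin (a (t, x)) (v (t, x))) :
    ∀ (t : ℝ) (x : EuclideanSpace ℝ (Fin n)),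
      (deriv (fun τ => ‖v (τ, x)‖ ^ 2) t
        + @inner ℝ _ _ (gradient (fun y => ‖v (t, y)‖ ^ 2) x) (u (t, x))
        + ‖v (t, x)‖ ^ 2 * sdiv (fun y => u (t, y)) x
        = 2 * c (t, x) * ‖v (t, x)‖ ^ 2) ∧
      (deriv (fun τ => ‖v (τ, x)‖ ^ 2) t
        + @inner ℝ _ _ (gradient (fun y => ‖v (t, y)‖ ^ 2) x) (u (t, x))
        + ‖v (t, x)‖ ^ 2 * sdiv (fun y => u (t, y)) x
        = (2 / (k : ℝ)) * Matrix.trace (a (t, x)) * ‖v (t, x)‖ ^ 2) := by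
  intro t x
  have hvd : Differentiable ℝ v := hv.differentiable one_ne_zero
  have hvt : DifferentiableAt ℝ (fun τ => v (τ, x)) t := by fun_prop
  have hvx : DifferentiableAt ℝ (fun y => v (t, y)) x := by fun_prop
  have hskew := inner_toEuclideanLin_self_eq_zero_of_transpose_eq_neg (hsskew t x) (v (t, x))
  have hid : Matrix.toEuclideanLin (1 : Matrix (Fin k) (Fin k) ℝ) (v (t, x)) = v (t, x) := by
    ext i
    simp
  have main : deriv (fun τ => ‖v (τ, x)‖ ^ 2) t
      + @inner ℝ _ _ (gradient (fun y => ‖v (t, y)‖ ^ 2) x) (u (t, x))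
      + ‖v (t, x)‖ ^ 2 * sdiv (fun y => u (t, y)) x
      = 2 * c (t, x) * ‖v (t, x)‖ ^ 2 := by
    rw [deriv_norm_sq_eq hvt, inner_gradient_norm_sq hvx, htransport, hadef, map_add, map_smul,
      LinearMap.add_apply, LinearMap.smul_apply, hid, inner_add_right, inner_add_right,
      inner_sub_right, inner_neg_right, inner_smul_right, inner_smul_right, hskew,
      real_inner_self_eq_norm_sq]
    ring
  refine ⟨main, main.trans ?_⟩
  rw [hadef, Matrix.trace_add, trace_eq_zero_of_transpose_eq_neg (hsskew t x), Matrix.trace_smul,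
    Matrix.trace_one, Fintype.card_fin, smul_eq_mul, zero_add]
  rcases Nat.eq_zero_or_pos k with rfl | hk
  · simp [Subsingleton.elim (v (t, x)) 0]
  · have : (k : ℝ) ≠ 0 := by positivity
    field_simp

end
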